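/- For all integers k ≥ 1 and n ≥ 0, the number of non-crossing pair partitions of {1,…,2n} in which every pair has depth at most k−1 equals ∑_{j=1}^{k} (1/(k+1))·(1 − cos(2jπ/(k+1)))·(2cos(jπ/(k+1)))^(2n). -/

import Mathlib

def IsPairPartition (m : ℕ) (π : Finset (Finset ℕ)) : Prop :=
  (∀ P ∈ π, P.card = 2) ∧
  (∀ i : ℕ, (∃ P ∈ π, i ∈ P) ↔ i ∈ Finset.Icc 1 m) ∧
  (∀ P ∈ π, ∀ Q ∈ π, P ≠ Q → Disjoint P Q)

/-- Non-crossing: there are no two pairs `{a,c}`, `{b,d}` with `a < b < c < d`. -/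
def NonCrossing (π : Finset (Finset ℕ)) : Prop :=
  ∀ P ∈ π, ∀ Q ∈ π, P ≠ Q →
    ¬ ∃ a ∈ P, ∃ b ∈ Q, ∃ c ∈ P, ∃ d ∈ Q, a < b ∧ b < c ∧ c < d

/-- `P` is nested inside `Q = {c, d}` (`c < d`) if `c < min P` and `max P < d`. -/
def Nested (P Q : Finset ℕ) : Prop :=
  ∃ c ∈ Q, ∃ d ∈ Q, ∀ x ∈ P, c < x ∧ x < d

/-- The depth of the pair `P` in `π`: the number of pairs `Q ∈ π` with `Q = P`
or `P` nested inside `Q`. -/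
noncomputable def pairDepth (π : Finset (Finset ℕ)) (P : Finset ℕ) : ℕ :=
  Set.ncard {Q : Finset ℕ | Q ∈ π ∧ (Q = P ∨ Nested P Q)}

/-- A non-crossing configuration of pairs `π` and open points `T` on `{1, …, m}`, with no open
point inside a pair. An open point counts as an outer pair for everything to its right, and all
depths are at most `K`. -/
structure IsOpenPairing (K m : ℕ) (π : Finset (Finset ℕ)) (T : Finset ℕ) : Prop where
  card_eq : ∀ P ∈ π, P.card = 2
  cover : ∀ i : ℕ, ((∃ P ∈ π, i ∈ P) ∨ i ∈ T) ↔ i ∈ Finset.Icc 1 m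
  disj : ∀ P ∈ π, ∀ Q ∈ π, P ≠ Q → Disjoint P Q
  notMem : ∀ P ∈ π, ∀ t ∈ T, t ∉ P
  nonCrossing : NonCrossing π
  uncovered : ∀ P ∈ π, ∀ t ∈ T, ∀ a ∈ P, ∀ b ∈ P, ¬ (a < t ∧ t < b)
  depth_le : ∀ P ∈ π, pairDepth π P + (T.filter fun t => ∀ x ∈ P, t < x).card ≤ K
  card_le : T.card ≤ K

lemma nested_pair_iff {a b : ℕ} {Q : Finset ℕ} (hab : a < b) (hQ : Q.Nonempty) :
    Nested Q {a, b} ↔ ∀ x ∈ Q, a < x ∧ x < b := by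
  obtain ⟨y, hy⟩ := hQ
  simp only [Nested, Finset.mem_insert, Finset.mem_singleton, exists_eq_or_imp, exists_eq_left]
  constructor
  · rintro ((h | h) | (h | h)) x hx <;> have h1 := h x hx <;> omega
  · intro h
    exact Or.inl (Or.inr h)

open Classical in
lemma pairDepth_eq_card (π : Finset (Finset ℕ)) (P : Finset ℕ) :
    pairDepth π P = (π.filter fun Q => Q = P ∨ Nested P Q).card := by
  rw [pairDepth, ← Set.ncard_coe_finset]
  congr 1
  ext
  simp

open Classical in
lemma pairDepth_insert {π : Finset (Finset ℕ)} {R : Finset ℕ} (hR : R ∉ π) (P : Finset ℕ) :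
    pairDepth (insert R π) P = pairDepth π P + if R = P ∨ Nested P R then 1 else 0 := by
  simp only [pairDepth_eq_card, Finset.filter_insert]
  split_ifs
  · rw [Finset.card_insert_of_notMem (by simp [hR])]
  · rfl

/-- Closing an open point `a` with a new last point `b` does not change the depth of a pair. -/
lemma depth_insert_pair {π : Finset (Finset ℕ)} {T Q : Finset ℕ} {a b : ℕ} (haT : a ∉ T)
    (hR : {a, b} ∉ π) (hab : a < b) (hQ : Q ∈ π) (hne : Q.Nonempty) (hlt : ∀ x ∈ Q, x < b) :
    pairDepth (insert {a, b} π) Q + (T.filter fun t => ∀ x ∈ Q, t < x).card =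
      pairDepth π Q + ((insert a T).filter fun t => ∀ x ∈ Q, t < x).card := by
  have hne' : ({a, b} : Finset ℕ) ≠ Q := by rintro rfl; exact hR hQ
  have hiff : (({a, b} : Finset ℕ) = Q ∨ Nested Q {a, b}) ↔ ∀ x ∈ Q, a < x := by
    rw [nested_pair_iff hab hne]
    simp only [hne', false_or]
    exact ⟨fun h x hx => (h x hx).1, fun h x hx => ⟨h x hx, hlt x hx⟩⟩
  rw [pairDepth_insert hR, Finset.filter_insert]
  simp only [hiff]
  split_ifs
  · rw [Finset.card_insert_of_notMem (by simp [haT])]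
    ring
  · rfl

lemma pairDepth_insert_last {π : Finset (Finset ℕ)} {a b : ℕ}
    (hle : ∀ Q ∈ π, ∀ x ∈ Q, x ≤ b) : pairDepth (insert {a, b} π) {a, b} = 1 := by
  classical
  rw [pairDepth_eq_card, Finset.card_eq_one]
  refine ⟨{a, b}, ?_⟩
  ext Q
  simp only [Finset.mem_filter, Finset.mem_insert, Finset.mem_singleton]
  constructor
  · rintro ⟨hQ, rfl | ⟨c, -, d, hd, h⟩⟩
    · rfl
    · rcases hQ with rfl | hQ
      · rfl
      · have h1 := hle Q hQ d hd
        have h2 := h b (by simp)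
        omega
  · rintro rfl
    simp

namespace IsOpenPairing

variable {K m a : ℕ} {π : Finset (Finset ℕ)} {T : Finset ℕ}

lemma mem_Icc_of_mem (h : IsOpenPairing K m π T) {P : Finset ℕ} (hP : P ∈ π) {x : ℕ}
    (hx : x ∈ P) : 1 ≤ x ∧ x ≤ m :=
  Finset.mem_Icc.1 ((h.cover x).1 (Or.inl ⟨P, hP, hx⟩))

lemma mem_Icc_of_mem_open (h : IsOpenPairing K m π T) {t : ℕ} (ht : t ∈ T) : 1 ≤ t ∧ t ≤ m :=
  Finset.mem_Icc.1 ((h.cover t).1 (Or.inr ht))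

lemma nonempty (h : IsOpenPairing K m π T) {P : Finset ℕ} (hP : P ∈ π) : P.Nonempty := by
  rw [← Finset.card_pos, h.card_eq P hP]
  norm_num

lemma filter_insert_last {P : Finset ℕ} {b : ℕ} (hne : P.Nonempty) (hle : ∀ x ∈ P, x ≤ b) :
    ((insert b T).filter fun t => ∀ x ∈ P, t < x) = T.filter fun t => ∀ x ∈ P, t < x := by
  rw [Finset.filter_insert, if_neg]
  intro h
  obtain ⟨x, hx⟩ := hne
  have := h x hx
  have := hle x hx
  omega

lemma insert_open (h : IsOpenPairing K m π T) (hT : T.card + 1 ≤ K) :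
    IsOpenPairing K (m + 1) π (insert (m + 1) T) where
  card_eq := h.card_eq
  cover i := by
    have := h.cover i
    simp only [Finset.mem_Icc, Finset.mem_insert] at this ⊢
    grind
  disj := h.disj
  notMem P hP t ht htP := by
    rcases Finset.mem_insert.1 ht with rfl | ht
    · have := h.mem_Icc_of_mem hP htP
      omega
    · exact h.notMem P hP t ht htP
  nonCrossing := h.nonCrossing
  uncovered P hP t ht x hx y hy hxy := by
    rcases Finset.mem_insert.1 ht with rfl | ht
    · have := h.mem_Icc_of_mem hP hy
      omega
    · exact h.uncovered P hP t ht x hx y hy hxy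
  depth_le P hP := by
    rw [filter_insert_last (h.nonempty hP)
      (fun x hx => (h.mem_Icc_of_mem hP hx).2.trans (Nat.le_succ m))]
    exact h.depth_le P hP
  card_le := (Finset.card_insert_le _ _).trans hT

lemma of_insert_open (h : IsOpenPairing K (m + 1) π (insert (m + 1) T)) (hT : m + 1 ∉ T) :
    IsOpenPairing K m π T where
  card_eq := h.card_eq
  cover i := by
    have := h.cover i
    have := h.notMem
    simp only [Finset.mem_Icc, Finset.mem_insert] at *
    grind
  disj := h.disj
  notMem P hP t ht := h.notMem P hP t (Finset.mem_insert_of_mem ht)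
  nonCrossing := h.nonCrossing
  uncovered P hP t ht := h.uncovered P hP t (Finset.mem_insert_of_mem ht)
  depth_le P hP := by
    rw [← filter_insert_last (h.nonempty hP) (fun x hx => (h.mem_Icc_of_mem hP hx).2)]
    exact h.depth_le P hP
  card_le := (Finset.card_le_card (Finset.subset_insert _ _)).trans h.card_le

lemma pair_notMem (h : IsOpenPairing K m π T) : ({a, m + 1} : Finset ℕ) ∉ π := fun hP => by
  have := h.mem_Icc_of_mem hP (x := m + 1) (by simp)
  omega

lemma insert_pair (h : IsOpenPairing K m π (insert a T)) (haT : a ∉ T) (hlt : ∀ t ∈ T, t < a) :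
    IsOpenPairing K (m + 1) (insert {a, m + 1} π) T := by
  have ha := h.mem_Icc_of_mem_open (Finset.mem_insert_self a T)
  have hTle : ∀ t ∈ T, 1 ≤ t ∧ t ≤ m := fun t ht =>
    h.mem_Icc_of_mem_open (Finset.mem_insert_of_mem ht)
  have hmem : ∀ P ∈ π, ∀ x ∈ P, 1 ≤ x ∧ x ≤ m := fun P hP x hx => h.mem_Icc_of_mem hP hx
  have haP : ∀ P ∈ π, a ∉ P := fun P hP => h.notMem P hP a (Finset.mem_insert_self a T)
  have hunc : ∀ P ∈ π, ∀ x ∈ P, ∀ y ∈ P, ¬ (x < a ∧ a < y) := fun P hP =>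
    h.uncovered P hP a (Finset.mem_insert_self a T)
  have hdis : ∀ P ∈ π, Disjoint ({a, m + 1} : Finset ℕ) P := fun P hP => by
    rw [Finset.disjoint_left]
    intro x hx hxP
    have := hmem P hP x hxP
    rcases Finset.mem_insert.1 hx with rfl | hx
    · exact haP P hP hxP
    · rw [Finset.mem_singleton] at hx
      omega
  constructor
  · intro P hP
    rcases Finset.mem_insert.1 hP with rfl | hP
    · exact Finset.card_pair (by omega)
    · exact h.card_eq P hP
  · intro i
    have := h.cover i
    simp only [Finset.mem_Icc, Finset.mem_insert, exists_eq_or_imp,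
      Finset.mem_singleton] at this ⊢
    grind
  · intro P hP Q hQ hne
    rcases Finset.mem_insert.1 hP with rfl | hP <;> rcases Finset.mem_insert.1 hQ with rfl | hQ
    · exact absurd rfl hne
    · exact hdis Q hQ
    · exact (hdis P hP).symm
    · exact h.disj P hP Q hQ hne
  · intro P hP t ht htP
    have := hlt t ht
    have := hTle t ht
    rcases Finset.mem_insert.1 hP with rfl | hP
    · simp only [Finset.mem_insert, Finset.mem_singleton] at htP
      omega
    · exact h.notMem P hP t (Finset.mem_insert_of_mem ht) htP
  · rintro P hP Q hQ hne ⟨x, hx, y, hy, z, hz, w, hw, hxy, hyz, hzw⟩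
    rcases Finset.mem_insert.1 hP with rfl | hP <;> rcases Finset.mem_insert.1 hQ with rfl | hQ
    · exact hne rfl
    · have := hmem Q hQ w hw
      simp only [Finset.mem_insert, Finset.mem_singleton] at hx hz
      omega
    · have := hmem P hP x hx
      have := hmem P hP z hz
      simp only [Finset.mem_insert, Finset.mem_singleton] at hy hw
      have hya : y = a := by omega
      exact hunc P hP x hx z hz ⟨hya ▸ hxy, hya ▸ hyz⟩
    · exact h.nonCrossing P hP Q hQ hne ⟨x, hx, y, hy, z, hz, w, hw, hxy, hyz, hzw⟩
  · intro P hP t ht x hx y hy hxy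
    rcases Finset.mem_insert.1 hP with rfl | hP
    · have := hlt t ht
      have := hTle t ht
      simp only [Finset.mem_insert, Finset.mem_singleton] at hx hy
      omega
    · exact h.uncovered P hP t (Finset.mem_insert_of_mem ht) x hx y hy hxy
  · intro P hP
    rcases Finset.mem_insert.1 hP with rfl | hP
    · rw [pairDepth_insert_last fun Q hQ x hx => (hmem Q hQ x hx).2.trans m.le_succ]
      have h1 := h.card_le
      rw [Finset.card_insert_of_notMem haT] at h1
      exact (Nat.add_le_add_left (Finset.card_filter_le _ _) 1).trans (by omega)
    · rw [depth_insert_pair haT h.pair_notMem (by omega) hP (h.nonempty hP)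
        fun x hx => Nat.lt_succ_of_le (hmem P hP x hx).2]
      exact h.depth_le P hP
  · exact (Finset.card_le_card (Finset.subset_insert _ _)).trans h.card_le

lemma lt_last (h : IsOpenPairing K (m + 1) (insert {a, m + 1} π) T) : a < m + 1 := by
  have h1 := h.card_eq _ (Finset.mem_insert_self _ _)
  have h2 := h.mem_Icc_of_mem (Finset.mem_insert_self _ _) (x := a) (by simp)
  rcases h2.2.lt_or_eq with h3 | h3
  · exact h3
  · simp [h3] at h1

lemma open_lt_of_insert_pair (h : IsOpenPairing K (m + 1) (insert {a, m + 1} π) T) :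
    ∀ t ∈ T, t < a := by
  intro t ht
  have h1 := h.uncovered _ (Finset.mem_insert_self _ _) t ht a (by simp) (m + 1) (by simp)
  have h2 := h.notMem _ (Finset.mem_insert_self _ _) t ht
  have h3 := h.mem_Icc_of_mem_open ht
  simp only [Finset.mem_insert, Finset.mem_singleton] at h2
  omega

lemma of_insert_pair (h : IsOpenPairing K (m + 1) (insert {a, m + 1} π) T)
    (hR : {a, m + 1} ∉ π) : IsOpenPairing K m π (insert a T) := by
  have ham := h.lt_last
  have hlt := h.open_lt_of_insert_pair
  have haT : a ∉ T := fun haT => (hlt a haT).false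
  have hdis : ∀ P ∈ π, Disjoint ({a, m + 1} : Finset ℕ) P := fun P hP =>
    h.disj _ (Finset.mem_insert_self _ _) P (Finset.mem_insert_of_mem hP)
      (by rintro rfl; exact hR hP)
  have haP : ∀ P ∈ π, a ∉ P := fun P hP => Finset.disjoint_left.1 (hdis P hP) (by simp)
  have hmP : ∀ P ∈ π, m + 1 ∉ P := fun P hP => Finset.disjoint_left.1 (hdis P hP) (by simp)
  have hmem : ∀ P ∈ π, ∀ x ∈ P, 1 ≤ x ∧ x < m + 1 := fun P hP x hx => by
    have h1 := h.mem_Icc_of_mem (Finset.mem_insert_of_mem hP) hx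
    have h2 : x ≠ m + 1 := by rintro rfl; exact hmP P hP hx
    omega
  constructor
  · exact fun P hP => h.card_eq P (Finset.mem_insert_of_mem hP)
  · intro i
    have := h.cover i
    have := hlt
    have := h.cover a
    simp only [Finset.mem_Icc, Finset.mem_insert, exists_eq_or_imp,
      Finset.mem_singleton] at *
    grind
  · exact fun P hP Q hQ =>
      h.disj P (Finset.mem_insert_of_mem hP) Q (Finset.mem_insert_of_mem hQ)
  · intro P hP t ht
    rcases Finset.mem_insert.1 ht with rfl | ht
    · exact haP P hP
    · exact h.notMem P (Finset.mem_insert_of_mem hP) t ht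
  · exact fun P hP Q hQ =>
      h.nonCrossing P (Finset.mem_insert_of_mem hP) Q (Finset.mem_insert_of_mem hQ)
  · rintro P hP t ht x hx y hy ⟨hxt, hty⟩
    rcases Finset.mem_insert.1 ht with rfl | ht
    · exact h.nonCrossing P (Finset.mem_insert_of_mem hP) _ (Finset.mem_insert_self _ _)
        (by rintro rfl; exact hR hP)
        ⟨x, hx, t, by simp, y, hy, m + 1, by simp, hxt, hty, (hmem P hP y hy).2⟩
    · exact h.uncovered P (Finset.mem_insert_of_mem hP) t ht x hx y hy ⟨hxt, hty⟩
  · intro P hP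
    have hne : P.Nonempty := h.nonempty (Finset.mem_insert_of_mem hP)
    rw [← depth_insert_pair haT hR ham hP hne fun x hx => (hmem P hP x hx).2]
    exact h.depth_le P (Finset.mem_insert_of_mem hP)
  · have h1 := h.depth_le _ (Finset.mem_insert_self _ _)
    rw [pairDepth_insert_last fun Q hQ x hx => (hmem Q hQ x hx).2.le,
      Finset.filter_true_of_mem] at h1
    · rw [Finset.card_insert_of_notMem haT]
      omega
    · intro t ht x hx
      have := hlt t ht
      simp only [Finset.mem_insert, Finset.mem_singleton] at hx
      omega

end IsOpenPairing

/-- The open pairings of `{1, …, m}` with `h` open points. -/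
def openPairings (K m h : ℕ) : Set (Finset (Finset ℕ) × Finset ℕ) :=
  {p | IsOpenPairing K m p.1 p.2 ∧ p.2.card = h}

lemma finite_openPairings (K m h : ℕ) : (openPairings K m h).Finite := by
  refine Set.Finite.subset (Finset.finite_toSet
    ((Finset.Icc 1 m).powerset.powerset ×ˢ (Finset.Icc 1 m).powerset)) ?_
  rintro ⟨π, T⟩ ⟨hp, -⟩
  simp only [Finset.coe_product, Set.mem_prod, Finset.mem_coe, Finset.mem_powerset]
  exact ⟨fun P hP => Finset.mem_powerset.2 fun x hx => (hp.cover x).1 (Or.inl ⟨P, hP, hx⟩),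
    fun t ht => (hp.cover t).1 (Or.inr ht)⟩

/-- Append an open point. -/
def appendOpen (m : ℕ) (p : Finset (Finset ℕ) × Finset ℕ) : Finset (Finset ℕ) × Finset ℕ :=
  (p.1, insert (m + 1) p.2)

/-- Append a point and pair it with the last open point. -/
def closeLast (m : ℕ) (p : Finset (Finset ℕ) × Finset ℕ) : Finset (Finset ℕ) × Finset ℕ :=
  (insert {p.2.sup id, m + 1} p.1, p.2.erase (p.2.sup id))

lemma sup_id_mem {T : Finset ℕ} (hT : T.Nonempty) : T.sup id ∈ T := by
  obtain ⟨a, ha, h⟩ := Finset.exists_mem_eq_sup T hT id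
  rw [h]
  exact ha

lemma injOn_appendOpen (K m h : ℕ) : Set.InjOn (appendOpen m) (openPairings K m h) := by
  rintro ⟨π, T⟩ ⟨hp, -⟩ ⟨π', T'⟩ ⟨hp', -⟩ heq
  simp only [appendOpen, Prod.mk.injEq] at heq
  have hT : m + 1 ∉ T := fun ht => by have := hp.mem_Icc_of_mem_open ht; omega
  have hT' : m + 1 ∉ T' := fun ht => by have := hp'.mem_Icc_of_mem_open ht; omega
  rw [Prod.mk.injEq, ← Finset.erase_insert hT, heq.2, Finset.erase_insert hT']
  exact ⟨heq.1, rfl⟩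

lemma injOn_closeLast (K m h : ℕ) : Set.InjOn (closeLast m) (openPairings K m (h + 1)) := by
  rintro ⟨π, T⟩ ⟨hp, hc⟩ ⟨π', T'⟩ ⟨hp', hc'⟩ heq
  simp only [closeLast, Prod.mk.injEq] at heq hc hc'
  obtain ⟨h1, h2⟩ := heq
  have hs := sup_id_mem (Finset.card_pos.1 (by omega : 0 < T.card))
  have hs' := sup_id_mem (Finset.card_pos.1 (by omega : 0 < T'.card))
  set a := T.sup id
  set b := T'.sup id
  have ha := hp.mem_Icc_of_mem_open hs
  have hab : a = b := by
    have hmem : ({a, m + 1} : Finset ℕ) ∈ insert {b, m + 1} π' := h1 ▸ Finset.mem_insert_self _ _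
    rcases Finset.mem_insert.1 hmem with h3 | h3
    · have h4 : a ∈ ({b, m + 1} : Finset ℕ) := h3 ▸ Finset.mem_insert_self _ _
      simp only [Finset.mem_insert, Finset.mem_singleton] at h4
      omega
    · exact absurd h3 hp'.pair_notMem
  rw [← hab] at h1 h2 hs'
  have hπ : ({a, m + 1} : Finset ℕ) ∉ π := hp.pair_notMem
  have hπ' : ({a, m + 1} : Finset ℕ) ∉ π' := hp'.pair_notMem
  rw [Prod.mk.injEq, ← Finset.insert_erase hs, h2, Finset.insert_erase hs',
    ← Finset.erase_insert hπ, h1, Finset.erase_insert hπ']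
  exact ⟨rfl, rfl⟩

lemma mem_openPairings_closeLast {K m h : ℕ} {p : Finset (Finset ℕ) × Finset ℕ}
    (hp : p ∈ openPairings K m (h + 1)) : closeLast m p ∈ openPairings K (m + 1) h := by
  obtain ⟨hp, hc⟩ := hp
  have hs := sup_id_mem (Finset.card_pos.1 (by omega : 0 < p.2.card))
  refine ⟨IsOpenPairing.insert_pair ?_ (Finset.notMem_erase _ _) ?_, ?_⟩
  · rw [closeLast, Finset.insert_erase hs]
    exact hp
  · intro t ht
    exact lt_of_le_of_ne (Finset.le_sup (f := id) (Finset.mem_of_mem_erase ht))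
      (Finset.ne_of_mem_erase ht)
  · rw [closeLast, Finset.card_erase_of_mem hs, hc]
    rfl

lemma mem_openPairings_appendOpen {K m h : ℕ} (hh : h < K) {p : Finset (Finset ℕ) × Finset ℕ}
    (hp : p ∈ openPairings K m h) : appendOpen m p ∈ openPairings K (m + 1) (h + 1) := by
  obtain ⟨hp, hc⟩ := hp
  refine ⟨hp.insert_open (by omega), ?_⟩
  rw [appendOpen, Finset.card_insert_of_notMem, hc]
  intro ht
  have := hp.mem_Icc_of_mem_open ht
  omega

/-- The last point is either open or closes a pair. -/
lemma openPairings_succ_cases {K m h : ℕ} {p : Finset (Finset ℕ) × Finset ℕ}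
    (hp : p ∈ openPairings K (m + 1) h) :
    (m + 1 ∈ p.2 ∧ ∃ q ∈ openPairings K m (h - 1), appendOpen m q = p) ∨
      (m + 1 ∉ p.2 ∧ ∃ q ∈ openPairings K m (h + 1), closeLast m q = p) := by
  obtain ⟨π, T⟩ := p
  obtain ⟨hp, hc⟩ := hp
  simp only at hp hc ⊢
  by_cases hT : m + 1 ∈ T
  · refine Or.inl ⟨hT, (π, T.erase (m + 1)), ⟨?_, ?_⟩, ?_⟩
    · exact IsOpenPairing.of_insert_open (by rwa [Finset.insert_erase hT])
        (Finset.notMem_erase _ _)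
    · rw [Finset.card_erase_of_mem hT, hc]
    · rw [appendOpen, Finset.insert_erase hT]
  · refine Or.inr ⟨hT, ?_⟩
    obtain ⟨P, hP, hmP⟩ := ((hp.cover (m + 1)).2 (by simp)).resolve_right hT
    obtain ⟨a, ha⟩ : ∃ a, P = {a, m + 1} := by
      obtain ⟨x, y, -, rfl⟩ := Finset.card_eq_two.1 (hp.card_eq P hP)
      simp only [Finset.mem_insert, Finset.mem_singleton] at hmP
      rcases hmP with rfl | rfl
      · exact ⟨y, Finset.pair_comm _ _⟩
      · exact ⟨x, rfl⟩
    subst ha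
    rw [← Finset.insert_erase hP] at hp
    have hlt := hp.open_lt_of_insert_pair
    have haT : a ∉ T := fun haT => (hlt a haT).false
    have hsup : (insert a T).sup id = a := by
      rw [Finset.sup_insert, id, sup_eq_left]
      exact Finset.sup_le fun t ht => (hlt t ht).le
    refine ⟨(π.erase {a, m + 1}, insert a T),
      ⟨hp.of_insert_pair (Finset.notMem_erase _ _), ?_⟩, ?_⟩
    · rw [Finset.card_insert_of_notMem haT, hc]
    · simp only [closeLast, hsup]
      rw [Finset.insert_erase hP, Finset.erase_insert haT]

lemma openPairings_succ_zero (K m : ℕ) :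
    openPairings K (m + 1) 0 = closeLast m '' openPairings K m 1 := by
  ext p
  constructor
  · intro hp
    rcases openPairings_succ_cases hp with ⟨h1, -⟩ | ⟨-, q, hq, rfl⟩
    · have := Finset.card_pos.2 ⟨_, h1⟩
      have := hp.2
      omega
    · exact ⟨q, hq, rfl⟩
  · rintro ⟨q, hq, rfl⟩
    exact mem_openPairings_closeLast hq

lemma openPairings_succ_succ {K m h : ℕ} (hh : h < K) :
    openPairings K (m + 1) (h + 1) =
      appendOpen m '' openPairings K m h ∪ closeLast m '' openPairings K m (h + 2) := by
  ext p
  constructor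
  · intro hp
    rcases openPairings_succ_cases hp with ⟨-, q, hq, rfl⟩ | ⟨-, q, hq, rfl⟩
    · exact Or.inl ⟨q, hq, rfl⟩
    · exact Or.inr ⟨q, hq, rfl⟩
  · rintro (⟨q, hq, rfl⟩ | ⟨q, hq, rfl⟩)
    · exact mem_openPairings_appendOpen hh hq
    · exact mem_openPairings_closeLast hq

lemma disjoint_appendOpen_closeLast (K m h h' : ℕ) :
    Disjoint (appendOpen m '' openPairings K m h) (closeLast m '' openPairings K m h') := by
  rw [Set.disjoint_left]
  rintro _ ⟨q, -, rfl⟩ ⟨q', hq', heq⟩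
  have h1 : m + 1 ∈ (closeLast m q').2 := heq ▸ Finset.mem_insert_self _ _
  have := hq'.1.mem_Icc_of_mem_open (Finset.mem_of_mem_erase h1)
  omega

lemma ncard_openPairings_succ_zero (K m : ℕ) :
    (openPairings K (m + 1) 0).ncard = (openPairings K m 1).ncard := by
  rw [openPairings_succ_zero, (injOn_closeLast K m 0).ncard_image]

lemma ncard_openPairings_succ_succ {K m h : ℕ} (hh : h < K) :
    (openPairings K (m + 1) (h + 1)).ncard =
      (openPairings K m h).ncard + (openPairings K m (h + 2)).ncard := by
  rw [openPairings_succ_succ hh, Set.ncard_union_eq (disjoint_appendOpen_closeLast _ _ _ _)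
    ((finite_openPairings _ _ _).image _) ((finite_openPairings _ _ _).image _),
    (injOn_appendOpen K m h).ncard_image,
    (injOn_closeLast K m (h + 1)).ncard_image]

lemma openPairings_eq_empty {K h : ℕ} (m : ℕ) (hh : K < h) : openPairings K m h = ∅ := by
  rw [Set.eq_empty_iff_forall_notMem]
  rintro p ⟨hp, hc⟩
  have := hp.card_le
  omega

lemma isOpenPairing_zero_iff {K : ℕ} {π : Finset (Finset ℕ)} {T : Finset ℕ} :
    IsOpenPairing K 0 π T ↔ π = ∅ ∧ T = ∅ := by
  constructor
  · intro h
    constructor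
    · rw [Finset.eq_empty_iff_forall_notMem]
      intro P hP
      obtain ⟨x, hx⟩ := h.nonempty hP
      have := h.mem_Icc_of_mem hP hx
      omega
    · rw [Finset.eq_empty_iff_forall_notMem]
      intro t ht
      have := h.mem_Icc_of_mem_open ht
      omega
  · rintro ⟨rfl, rfl⟩
    constructor <;> simp [NonCrossing]

lemma ncard_openPairings_zero (K h : ℕ) :
    (openPairings K 0 h).ncard = if h = 0 then 1 else 0 := by
  split_ifs with hh
  · rw [Set.ncard_eq_one]
    refine ⟨(∅, ∅), ?_⟩
    ext ⟨π, T⟩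
    simp only [openPairings, isOpenPairing_zero_iff, Set.mem_ofPred_eq, Set.mem_singleton_iff,
      Prod.mk.injEq, hh]
    exact ⟨fun h => h.1, fun h => ⟨h, by simp [h.2]⟩⟩
  · rw [Set.ncard_eq_zero (finite_openPairings _ _ _), Set.eq_empty_iff_forall_notMem]
    rintro ⟨π, T⟩ ⟨hp, hc⟩
    simp only [isOpenPairing_zero_iff] at hp
    simp only [hp.2, Finset.card_empty] at hc
    exact hh hc.symm

lemma two_mul_sin_half_mul_sum_cos (x : ℝ) (N : ℕ) :
    2 * Real.sin (x / 2) * ∑ j ∈ Finset.range N, Real.cos (j * x) =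
      Real.sin (N * x - x / 2) + Real.sin (x / 2) := by
  induction N with
  | zero => simp
  | succ N ih =>
    rw [Finset.sum_range_succ, mul_add, ih]
    have e : ((N + 1 : ℕ) : ℝ) * x - x / 2 = N * x + x / 2 := by push_cast; ring
    rw [e, Real.sin_sub, Real.sin_add]
    ring

/-- The sum is `0` for even `a` and `1` for odd `a`. -/
lemma sum_cos_mul_pi_div {N a : ℕ} (ha : 0 < a) (haN : a < 2 * N) :
    ∑ j ∈ Finset.range N, Real.cos (j * (a * (Real.pi / N))) = (1 - (-1) ^ a) / 2 := by
  have hN : (0 : ℝ) < N := by exact_mod_cast (by omega : 0 < N)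
  have ha' : (0 : ℝ) < a := by exact_mod_cast ha
  have haN' : (a : ℝ) < 2 * N := by exact_mod_cast haN
  set x : ℝ := a * (Real.pi / N) with hx
  have hpos : 0 < Real.sin (x / 2) := by
    apply Real.sin_pos_of_pos_of_lt_pi
    · positivity
    · have : x / 2 = Real.pi * (a / (2 * N)) := by rw [hx]; field_simp
      rw [this]
      exact mul_lt_of_lt_one_right Real.pi_pos ((div_lt_one (by positivity)).2 haN')
  have h := two_mul_sin_half_mul_sum_cos x N
  have e : (N : ℝ) * x = a * Real.pi := by rw [hx]; field_simp
  rw [e, Real.sin_nat_mul_pi_sub] at h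
  apply mul_left_cancel₀ (mul_pos two_pos hpos).ne'
  rw [h]
  ring

lemma sum_sin_mul_sin {k h : ℕ} (hk : 1 ≤ k) (hh : h < k) :
    ∑ j ∈ Finset.Icc 1 k, Real.sin (j * (Real.pi / (k + 1 : ℕ))) *
        Real.sin ((h + 1) * (j * (Real.pi / (k + 1 : ℕ)))) =
      if h = 0 then ((k : ℝ) + 1) / 2 else 0 := by
  have hterm : ∀ j : ℕ, Real.sin (j * (Real.pi / (k + 1 : ℕ))) *
        Real.sin ((h + 1) * (j * (Real.pi / (k + 1 : ℕ)))) =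
      (Real.cos (j * (h * (Real.pi / (k + 1 : ℕ)))) -
        Real.cos (j * ((h + 2 : ℕ) * (Real.pi / (k + 1 : ℕ))))) / 2 := fun j => by
    set y := (j : ℝ) * (Real.pi / (k + 1 : ℕ)) with hy
    have e1 : (j : ℝ) * (h * (Real.pi / (k + 1 : ℕ))) = (h + 1) * y - y := by rw [hy]; ring
    have e2 : (j : ℝ) * ((h + 2 : ℕ) * (Real.pi / (k + 1 : ℕ))) = (h + 1) * y + y := by
      rw [hy]; push_cast; ring
    rw [e1, e2, Real.cos_sub, Real.cos_add]
    ring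
  have hrange : ∑ j ∈ Finset.Icc 1 k, Real.sin (j * (Real.pi / (k + 1 : ℕ))) *
        Real.sin ((h + 1) * (j * (Real.pi / (k + 1 : ℕ)))) =
      ∑ j ∈ Finset.range (k + 1), Real.sin (j * (Real.pi / (k + 1 : ℕ))) *
        Real.sin ((h + 1) * (j * (Real.pi / (k + 1 : ℕ)))) := by
    apply Finset.sum_subset
    · intro j
      simp only [Finset.mem_Icc, Finset.mem_range]
      omega
    · intro j hj hj'
      simp only [Finset.mem_Icc, Finset.mem_range] at hj hj'
      obtain rfl : j = 0 := by omega
      simp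
  rw [hrange, Finset.sum_congr rfl fun j _ => hterm j, ← Finset.sum_div, Finset.sum_sub_distrib,
    sum_cos_mul_pi_div (a := h + 2) (by omega) (by omega)]
  split_ifs with h0
  · subst h0
    simp
  · rw [sum_cos_mul_pi_div (by omega) (by omega), pow_add]
    ring

/-- The spectral expression for the number of walks of length `m` from `0` to `h` on
`{0, …, k - 1}`. -/
noncomputable def pathWalkSum (k m h : ℕ) : ℝ :=
  ∑ j ∈ Finset.Icc 1 k, 2 / ((k : ℝ) + 1) * (Real.sin (j * (Real.pi / (k + 1 : ℕ))) *
    Real.sin ((h + 1) * (j * (Real.pi / (k + 1 : ℕ))))) *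
      (2 * Real.cos (j * (Real.pi / (k + 1 : ℕ)))) ^ m

lemma pathWalkSum_zero_left {k h : ℕ} (hk : 1 ≤ k) (hh : h < k) :
    pathWalkSum k 0 h = if h = 0 then 1 else 0 := by
  simp only [pathWalkSum, pow_zero, mul_one]
  rw [← Finset.mul_sum, sum_sin_mul_sin hk hh]
  split_ifs
  · field_simp
  · simp

lemma pathWalkSum_self (k m : ℕ) : pathWalkSum k m k = 0 := by
  refine Finset.sum_eq_zero fun j _ => ?_
  have e : ((k : ℝ) + 1) * (j * (Real.pi / (k + 1 : ℕ))) = j * Real.pi := by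
    push_cast
    field_simp
  rw [e, Real.sin_nat_mul_pi]
  simp

lemma pathWalkSum_succ_zero (k m : ℕ) : pathWalkSum k (m + 1) 0 = pathWalkSum k m 1 := by
  refine Finset.sum_congr rfl fun j _ => ?_
  set y := (j : ℝ) * (Real.pi / (k + 1 : ℕ))
  have e : ((1 : ℕ) + 1 : ℝ) * y = 2 * y := by norm_num
  rw [e, Real.sin_two_mul]
  simp only [Nat.cast_zero, zero_add, one_mul]
  ring

lemma pathWalkSum_succ_succ (k m h : ℕ) :
    pathWalkSum k (m + 1) (h + 1) = pathWalkSum k m h + pathWalkSum k m (h + 2) := by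
  rw [pathWalkSum, pathWalkSum, pathWalkSum, ← Finset.sum_add_distrib]
  refine Finset.sum_congr rfl fun j _ => ?_
  set y := (j : ℝ) * (Real.pi / (k + 1 : ℕ))
  have e1 : ((h : ℝ) + 1) * y = ((h + 1 : ℕ) + 1) * y - y := by push_cast; ring
  have e2 : ((h + 2 : ℕ) + 1 : ℝ) * y = ((h + 1 : ℕ) + 1) * y + y := by push_cast; ring
  rw [e1, e2, Real.sin_sub, Real.sin_add]
  ring

lemma ncard_openPairings (K m : ℕ) :
    ∀ h ≤ K + 1, ((openPairings K m h).ncard : ℝ) = pathWalkSum (K + 1) m h := by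
  have htop : ∀ m, ((openPairings K m (K + 1)).ncard : ℝ) = pathWalkSum (K + 1) m (K + 1) :=
    fun m => by rw [openPairings_eq_empty m K.lt_succ_self, pathWalkSum_self]; simp
  induction m with
  | zero =>
    intro h hh
    rcases hh.lt_or_eq with hh | rfl
    · rw [ncard_openPairings_zero, pathWalkSum_zero_left (by omega) hh]
      simp
    · exact htop 0
  | succ m ih =>
    intro h hh
    rcases hh.lt_or_eq with hh | rfl
    · cases h with
      | zero =>
        rw [ncard_openPairings_succ_zero, pathWalkSum_succ_zero]
        exact ih 1 (by omega)
      | succ h =>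
        rw [ncard_openPairings_succ_succ (by omega), pathWalkSum_succ_succ, Nat.cast_add,
          ih h (by omega), ih (h + 2) (by omega)]
    · exact htop (m + 1)

lemma isOpenPairing_empty_iff {K m : ℕ} {π : Finset (Finset ℕ)} :
    IsOpenPairing K m π ∅ ↔
      IsPairPartition m π ∧ NonCrossing π ∧ ∀ P ∈ π, pairDepth π P ≤ K := by
  constructor
  · intro h
    exact ⟨⟨h.card_eq, by simpa using h.cover, h.disj⟩, h.nonCrossing, by simpa using h.depth_le⟩
  · rintro ⟨⟨h1, h2, h3⟩, h4, h5⟩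
    exact ⟨h1, by simpa using h2, h3, by simp, h4, by simp, by simpa using h5, by simp⟩

lemma ncard_nonCrossing_eq (K m : ℕ) :
    {π : Finset (Finset ℕ) |
      IsPairPartition m π ∧ NonCrossing π ∧ ∀ P ∈ π, pairDepth π P ≤ K}.ncard =
        (openPairings K m 0).ncard := by
  rw [← Set.ncard_image_of_injective _ (Prod.mk_left_injective (∅ : Finset ℕ))]
  congr 1
  ext ⟨π, T⟩
  simp only [openPairings, Set.mem_image, Set.mem_ofPred_eq, Prod.mk.injEq,
    Finset.card_eq_zero, ← isOpenPairing_empty_iff]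
  constructor
  · rintro ⟨_, h, rfl, rfl⟩
    exact ⟨h, rfl⟩
  · rintro ⟨h, rfl⟩
    exact ⟨π, h, rfl, rfl⟩

theorem stmt15 (k : ℕ) (hk : 1 ≤ k) (n : ℕ) :
    (Set.ncard {π : Finset (Finset ℕ) |
        IsPairPartition (2 * n) π ∧ NonCrossing π ∧
        ∀ P ∈ π, pairDepth π P ≤ k - 1} : ℝ) =
      ∑ j ∈ Finset.Icc 1 k,
        (1 / ((k : ℝ) + 1)) * (1 - Real.cos (2 * (j : ℝ) * Real.pi / ((k : ℝ) + 1))) *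
          (2 * Real.cos ((j : ℝ) * Real.pi / ((k : ℝ) + 1))) ^ (2 * n) := by
  obtain ⟨K, rfl⟩ : ∃ K, k = K + 1 := ⟨k - 1, by omega⟩
  rw [Nat.add_sub_cancel, ncard_nonCrossing_eq, ncard_openPairings K _ 0 (by omega), pathWalkSum]
  refine Finset.sum_congr rfl fun j _ => ?_
  set y := (j : ℝ) * (Real.pi / (K + 1 + 1 : ℕ)) with hy
  have e1 : 2 * (j : ℝ) * Real.pi / (((K + 1 : ℕ) : ℝ) + 1) = 2 * y := by
    rw [hy]; push_cast; ring
  have e2 : (j : ℝ) * Real.pi / (((K + 1 : ℕ) : ℝ) + 1) = y := by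
    rw [hy]; push_cast; ring
  rw [e1, e2, Real.cos_two_mul, Real.cos_sq']
  simp only [Nat.cast_zero, zero_add, one_mul]
  ring
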